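/- Let n < N be positive integers and R > 0. Define ψ : ℝ^N × ℝ → ℝ by ψ(x,t) = ( 1 − R^{−2}( ‖x‖² + 2n t ) )₊⁴, where a₊ = max(a,0). Then: (i) ψ is twice continuously differentiable on ℝ^N × ℝ, and for every n-dimensional linear subspace L ⊆ ℝ^N with orthonormal basis e₁,…,eₙ and every (x,t), ∂_t ψ(x,t) − Σ_{i=1}^{n} (Hess_x ψ)(x,t)[e_i,e_i] ≤ 0; (ii) ψ(x,0) ≥ 1/16 whenever ‖x‖ ≤ R/2; (iii) ψ(x,t) = 0 whenever ‖x‖ ≥ 4R and −16R²/(5n) ≤ t ≤ 0. -/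

import Mathlib

open Real

noncomputable section

/-- The positive part raised to a power at least two is differentiable everywhere. -/
theorem hasDerivAt_max_zero_pow (k : ℕ) (u : ℝ) :
    HasDerivAt (fun v : ℝ => max v 0 ^ (k + 2)) ((k + 2) * max u 0 ^ (k + 1)) u := by
  have hpow : HasDerivAt (fun v : ℝ => v ^ (k + 2)) ((k + 2) * u ^ (k + 1)) u := by
    simpa using hasDerivAt_pow (k + 2) u
  rcases lt_trichotomy u 0 with h | rfl | h
  · rw [max_eq_right h.le, zero_pow (by omega), mul_zero]
    refine (hasDerivAt_const u (0 : ℝ)).congr_of_eventuallyEq ?_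
    filter_upwards [Iio_mem_nhds h] with v hv
    rw [max_eq_right (le_of_lt hv), zero_pow (by omega)]
  · have hleft : HasDerivWithinAt (fun v : ℝ => max v 0 ^ (k + 2)) 0 (Set.Iic 0) 0 := by
      refine (hasDerivWithinAt_const (0 : ℝ) _ (0 : ℝ)).congr (fun v hv => ?_) (by simp)
      rw [max_eq_right hv, zero_pow (by omega)]
    have hright : HasDerivWithinAt (fun v : ℝ => max v 0 ^ (k + 2)) 0 (Set.Ici 0) 0 := by
      have := hpow.hasDerivWithinAt (s := Set.Ici 0)
      rw [zero_pow (by omega), mul_zero] at this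
      refine this.congr (fun v hv => ?_) (by simp)
      rw [max_eq_left hv]
    simpa [Set.Iic_union_Ici] using hleft.union hright
  · rw [max_eq_left h.le]
    refine hpow.congr_of_eventuallyEq ?_
    filter_upwards [Ioi_mem_nhds h] with v hv
    rw [max_eq_left (le_of_lt hv)]

/-- The `(k + 1)`-st power of the positive part is `k` times continuously differentiable. -/
theorem contDiff_max_zero_pow (k : ℕ) :
    ContDiff ℝ k (fun v : ℝ => max v 0 ^ (k + 1)) := by
  induction k with
  | zero =>
    rw [Nat.cast_zero, contDiff_zero]
    fun_prop
  | succ k ih =>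
    rw [Nat.cast_add, Nat.cast_one, contDiff_succ_iff_deriv]
    refine ⟨fun u => (hasDerivAt_max_zero_pow k u).differentiableAt, by simp, ?_⟩
    rw [funext fun u => (hasDerivAt_max_zero_pow k u).deriv]
    exact contDiff_const.mul ih

section RadialProfile

variable {E : Type*} [NormedAddCommGroup E] [InnerProductSpace ℝ E]

theorem hasFDerivAt_radial (a c : ℝ) (x : E) :
    HasFDerivAt (fun y : E => a - c * ‖y‖ ^ 2) ((-2 * c) • innerSL ℝ x) x := by
  refine (((hasStrictFDerivAt_norm_sq x).hasFDerivAt.const_mul c).const_sub a).congr_fderiv ?_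
  ext v
  simp
  ring

/-- The Hessian of `(a - c ‖y‖²)₊⁴` on the diagonal. -/
theorem iteratedFDeriv_two_radial_max_zero_pow_four (a c : ℝ) (x v : E) :
    iteratedFDeriv ℝ 2 (fun y : E => max (a - c * ‖y‖ ^ 2) 0 ^ 4) x ![v, v] =
      48 * c ^ 2 * max (a - c * ‖x‖ ^ 2) 0 ^ 2 * inner ℝ x v ^ 2 -
        8 * c * max (a - c * ‖x‖ ^ 2) 0 ^ 3 * ‖v‖ ^ 2 := by
  have hfirst : fderiv ℝ (fun y : E => max (a - c * ‖y‖ ^ 2) 0 ^ 4) =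
      fun y => (-8 * c * max (a - c * ‖y‖ ^ 2) 0 ^ 3) • innerSL ℝ y := by
    funext y
    refine ((hasDerivAt_max_zero_pow 2 _).comp_hasFDerivAt y
      (hasFDerivAt_radial a c y)).fderiv.trans ?_
    rw [smul_smul]
    congr 1
    push_cast
    ring
  have hcoeff := ((hasDerivAt_max_zero_pow 1 _).comp_hasFDerivAt x
    (hasFDerivAt_radial a c x)).const_mul (-8 * c)
  have hsecond := hcoeff.smul (innerSL ℝ (E := E)).hasFDerivAt
  rw [iteratedFDeriv_two_apply, hfirst]
  refine (congrArg (fun T : E →L[ℝ] E →L[ℝ] ℝ => T v v) hsecond.fderiv).trans ?_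
  have hinner (y w : E) : innerSL ℝ y w = inner ℝ y w := rfl
  simp [hinner]
  ring

end RadialProfile

/-- The interior barrier `ψ(x,t) = (1 − R^{−2}(‖x‖² + 2nt))₊⁴`:
(i) it is C² and a subsolution `∂_t ψ − tr_L Hess ψ ≤ 0` for every `n`-dimensional
subspace `L`; (ii) `ψ(x,0) ≥ 1/16` for `‖x‖ ≤ R/2`; (iii) `ψ(x,t) = 0` for
`‖x‖ ≥ 4R` and `−16R²/(5n) ≤ t ≤ 0`. -/
theorem stmt_2 (n N : ℕ) (hn : 0 < n) (hnN : n < N) (R : ℝ) (hR : 0 < R)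
    (ψ : EuclideanSpace ℝ (Fin N) → ℝ → ℝ)
    (hψ : ∀ (x : EuclideanSpace ℝ (Fin N)) (t : ℝ),
      ψ x t = (max (1 - (R ^ 2)⁻¹ * (‖x‖ ^ 2 + 2 * n * t)) 0) ^ 4) :
    (ContDiff ℝ 2 (fun p : EuclideanSpace ℝ (Fin N) × ℝ => ψ p.1 p.2) ∧
      ∀ (L : Submodule ℝ (EuclideanSpace ℝ (Fin N)))
        (e : Fin n → EuclideanSpace ℝ (Fin N)),
        Orthonormal ℝ e → Submodule.span ℝ (Set.range e) = L →
        ∀ (x : EuclideanSpace ℝ (Fin N)) (t : ℝ),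
          deriv (fun s => ψ x s) t
              - ∑ i : Fin n, (iteratedFDeriv ℝ 2 (fun y => ψ y t) x) ![e i, e i] ≤ 0) ∧
    (∀ x : EuclideanSpace ℝ (Fin N), ‖x‖ ≤ R / 2 → 1 / 16 ≤ ψ x 0) ∧
    (∀ (x : EuclideanSpace ℝ (Fin N)) (t : ℝ), 4 * R ≤ ‖x‖ →
      -(16 * R ^ 2 / (5 * n)) ≤ t → t ≤ 0 → ψ x t = 0) := by
  have hc : 0 < (R ^ 2)⁻¹ := by positivity
  have hcR : (R ^ 2)⁻¹ * R ^ 2 = 1 := inv_mul_cancel₀ (by positivity)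
  refine ⟨⟨?_, ?_⟩, ?_, ?_⟩
  · simp only [hψ]
    have hpow : ContDiff ℝ 2 (fun v : ℝ => max v 0 ^ 4) :=
      (contDiff_max_zero_pow 3).of_le (by norm_num)
    refine hpow.comp (g := fun v : ℝ => max v 0 ^ 4)
      (f := fun p : EuclideanSpace ℝ (Fin N) × ℝ =>
        1 - (R ^ 2)⁻¹ * (‖p.1‖ ^ 2 + 2 * n * p.2)) ?_
    have := (contDiff_fst (𝕜 := ℝ) (n := 2) (E := EuclideanSpace ℝ (Fin N)) (F := ℝ)).norm_sq ℝ
    fun_prop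
  · intro L e he _ x t
    have htime : deriv (fun s => ψ x s) t =
        -(8 * n * (R ^ 2)⁻¹ * max (1 - (R ^ 2)⁻¹ * (‖x‖ ^ 2 + 2 * n * t)) 0 ^ 3) := by
      simp only [hψ]
      have hinner := ((((hasDerivAt_id t).const_mul (2 * (n : ℝ))).const_add
        (‖x‖ ^ 2)).const_mul (R ^ 2)⁻¹).const_sub 1
      refine ((hasDerivAt_max_zero_pow 2 _).comp t hinner).deriv.trans ?_
      simp only [id]
      push_cast
      ring
    have hspace : (fun y => ψ y t) = fun y => max
        ((1 - (R ^ 2)⁻¹ * (2 * n * t)) - (R ^ 2)⁻¹ * ‖y‖ ^ 2) 0 ^ 4 := by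
      funext y
      rw [hψ]
      ring_nf
    have harg : 1 - (R ^ 2)⁻¹ * (2 * n * t) - (R ^ 2)⁻¹ * ‖x‖ ^ 2 =
        1 - (R ^ 2)⁻¹ * (‖x‖ ^ 2 + 2 * n * t) := by ring
    simp only [htime, hspace, iteratedFDeriv_two_radial_max_zero_pow_four, harg, he.1,
      Finset.sum_sub_distrib, ← Finset.mul_sum, Finset.sum_const, Finset.card_univ,
      Fintype.card_fin, nsmul_eq_mul]
    have hnonneg : 0 ≤ 48 * ((R ^ 2)⁻¹) ^ 2 *
        max (1 - (R ^ 2)⁻¹ * (‖x‖ ^ 2 + 2 * n * t)) 0 ^ 2 * ∑ i, inner ℝ x (e i) ^ 2 := by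
      positivity
    linarith
  · intro x hx
    have hsq : ‖x‖ ^ 2 ≤ R ^ 2 / 4 := by nlinarith [norm_nonneg x]
    have hmul := mul_le_mul_of_nonneg_left hsq hc.le
    have hbase : (1 / 2 : ℝ) ≤ max (1 - (R ^ 2)⁻¹ * (‖x‖ ^ 2 + 2 * n * 0)) 0 :=
      le_max_of_le_left (by linarith)
    rw [hψ]
    calc (1 / 16 : ℝ) = (1 / 2) ^ 4 := by norm_num
      _ ≤ _ := by gcongr
  · intro x t hx ht _
    have hn' : (0 : ℝ) < n := by exact_mod_cast hn
    have hsq : 16 * R ^ 2 ≤ ‖x‖ ^ 2 := by nlinarith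
    have ht' : -(32 * R ^ 2 / 5) ≤ 2 * n * t := by
      calc -(32 * R ^ 2 / 5) = 2 * n * -(16 * R ^ 2 / (5 * n)) := by field_simp; ring
        _ ≤ _ := by gcongr
    have hsum : R ^ 2 ≤ ‖x‖ ^ 2 + 2 * n * t := by nlinarith
    have hmul := mul_le_mul_of_nonneg_left hsum hc.le
    rw [hψ, max_eq_right (by linarith), zero_pow (by norm_num)]
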